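/- Let f : ℝ^d → ℝ^m be a bounded measurable function with M = 2·sup_x ‖f(x)‖₂, and let g(x) = E_{η∼N(0,σ²I)}[f(x+η)] be its Gaussian smoothing. Then g is (M/(√(2π)·σ))-Lipschitz: for all x, δ, ‖g(x) − g(x+δ)‖₂ ≤ (M/(√(2π)σ))·‖δ‖₂. -/

import Mathlib

open MeasureTheory Filter

/-- Density of the isotropic Gaussian `N(0, σ²I)` on `ℝ^d`. -/
noncomputable def gaussDensity (d : ℕ) (σ : ℝ) (z : EuclideanSpace ℝ (Fin d)) : ℝ :=
  (2 * Real.pi * σ ^ 2) ^ (-(d : ℝ) / 2) * Real.exp (-‖z‖ ^ 2 / (2 * σ ^ 2))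

theorem integral_abs_mul_exp_neg_mul_sq {b : ℝ} (hb : 0 < b) :
    ∫ x : ℝ, |x| * Real.exp (-b * x ^ 2) = b⁻¹ := by
  have hd (x : ℝ) : HasDerivAt (fun y ↦ -(2 * b)⁻¹ * Real.exp (-b * y ^ 2))
      (x * Real.exp (-b * x ^ 2)) x := by
    refine ((((hasDerivAt_pow 2 x).const_mul (-b)).exp).const_mul (-(2 * b)⁻¹)).congr_deriv ?_
    field_simp
    simp
  have ht : Tendsto (fun y : ℝ ↦ -(2 * b)⁻¹ * Real.exp (-b * y ^ 2)) atTop (nhds 0) := by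
    rw [← mul_zero (-(2 * b)⁻¹)]
    refine (Real.tendsto_exp_atBot.comp ?_).const_mul _
    exact (tendsto_pow_atTop two_ne_zero).const_mul_atTop_of_neg (neg_lt_zero.mpr hb)
  have hI : ∫ x in Set.Ioi (0 : ℝ), x * Real.exp (-b * x ^ 2) = (2 * b)⁻¹ := by
    rw [integral_Ioi_of_hasDerivAt_of_tendsto' (fun x _ ↦ hd x)
      (integrable_mul_exp_neg_mul_sq hb).integrableOn ht]
    simp
  have h := integral_comp_abs (f := fun x : ℝ ↦ x * Real.exp (-b * x ^ 2))
  simp only [sq_abs] at h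
  rw [h, hI]
  field_simp

theorem gaussianPDFReal_zero_toNNReal_sq (σ x : ℝ) :
    ProbabilityTheory.gaussianPDFReal 0 (σ ^ 2).toNNReal x =
      (√(2 * Real.pi * σ ^ 2))⁻¹ * Real.exp (-(2 * σ ^ 2)⁻¹ * x ^ 2) := by
  rw [ProbabilityTheory.gaussianPDFReal, Real.coe_toNNReal _ (sq_nonneg σ), sub_zero]
  congr 2
  ring

theorem integrable_abs_mul_gaussianPDFReal {σ : ℝ} (hσ : 0 < σ) :
    Integrable fun x ↦ |x| * ProbabilityTheory.gaussianPDFReal 0 (σ ^ 2).toNNReal x := by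
  simp only [gaussianPDFReal_zero_toNNReal_sq]
  have hb : 0 < (2 * σ ^ 2)⁻¹ := by positivity
  refine ((integrable_mul_exp_neg_mul_sq hb).norm.const_mul
    (√(2 * Real.pi * σ ^ 2))⁻¹).congr (ae_of_all _ fun x ↦ ?_)
  simp only [norm_mul, Real.norm_eq_abs, Real.abs_exp]
  ring

theorem integral_abs_mul_gaussianPDFReal {σ : ℝ} (hσ : 0 < σ) :
    ∫ x, |x| * ProbabilityTheory.gaussianPDFReal 0 (σ ^ 2).toNNReal x =
      2 * σ / √(2 * Real.pi) := by
  have hb : 0 < (2 * σ ^ 2)⁻¹ := by positivity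
  simp only [gaussianPDFReal_zero_toNNReal_sq, mul_left_comm |_|]
  rw [integral_const_mul, integral_abs_mul_exp_neg_mul_sq hb, Real.sqrt_mul (by positivity),
    Real.sqrt_sq hσ.le]
  field_simp

theorem gaussDensity_eq_prod {d : ℕ} {σ : ℝ} (hσ : 0 < σ) (z : EuclideanSpace ℝ (Fin d)) :
    gaussDensity d σ z = ∏ i, ProbabilityTheory.gaussianPDFReal 0 (σ ^ 2).toNNReal (z i) := by
  have h2 : 0 ≤ 2 * Real.pi * σ ^ 2 := by positivity
  simp only [gaussianPDFReal_zero_toNNReal_sq, Finset.prod_mul_distrib, ← Real.exp_sum,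
    ← Finset.mul_sum, Finset.prod_const, Finset.card_univ, Fintype.card_fin]
  rw [gaussDensity, EuclideanSpace.real_norm_sq_eq, Real.sqrt_eq_rpow, ← Real.rpow_neg h2,
    ← Real.rpow_mul_natCast h2]
  congr 2 <;> ring

theorem gaussDensity_nonneg (d : ℕ) (σ : ℝ) (z : EuclideanSpace ℝ (Fin d)) :
    0 ≤ gaussDensity d σ z := by
  unfold gaussDensity
  positivity

theorem continuous_gaussDensity (d : ℕ) (σ : ℝ) : Continuous (gaussDensity d σ) := by
  unfold gaussDensity
  fun_prop

theorem integrable_gaussDensity (d : ℕ) {σ : ℝ} (hσ : 0 < σ) : Integrable (gaussDensity d σ) := by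
  rw [← (PiLp.volume_preserving_toLp (Fin d)).integrable_comp_emb
    (MeasurableEquiv.toLp 2 _).measurableEmbedding]
  simp only [Function.comp_def, gaussDensity_eq_prod hσ]
  exact Integrable.fintype_prod fun _ ↦ ProbabilityTheory.integrable_gaussianPDFReal _ _

theorem gaussDensity_mul_abs_eq_prod {d : ℕ} {σ : ℝ} (hσ : 0 < σ) (i : Fin d)
    (z : EuclideanSpace ℝ (Fin d)) :
    gaussDensity d σ z * |z i| =
      ∏ j, Function.update (fun _ ↦ ProbabilityTheory.gaussianPDFReal 0 (σ ^ 2).toNNReal) i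
        (fun x ↦ |x| * ProbabilityTheory.gaussianPDFReal 0 (σ ^ 2).toNNReal x) j (z j) := by
  rw [gaussDensity_eq_prod hσ, ← Finset.mul_prod_erase _ _ (Finset.mem_univ i),
    ← Finset.mul_prod_erase _ _ (Finset.mem_univ i), Function.update_self,
    Finset.prod_congr (M := ℝ) rfl fun j hj ↦ congrFun
      (Function.update_of_ne (Finset.ne_of_mem_erase hj) _
        fun _ ↦ ProbabilityTheory.gaussianPDFReal 0 (σ ^ 2).toNNReal).symm (z j)]
  ring

theorem integrable_gaussDensity_mul_abs_apply {d : ℕ} {σ : ℝ} (hσ : 0 < σ) (i : Fin d) :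
    Integrable fun z ↦ gaussDensity d σ z * |z i| := by
  rw [← (PiLp.volume_preserving_toLp (Fin d)).integrable_comp_emb
    (MeasurableEquiv.toLp 2 _).measurableEmbedding]
  simp only [Function.comp_def, gaussDensity_mul_abs_eq_prod hσ]
  refine Integrable.fintype_prod fun j ↦ ?_
  obtain rfl | hj := eq_or_ne j i
  · simpa using integrable_abs_mul_gaussianPDFReal hσ
  · simpa [hj] using ProbabilityTheory.integrable_gaussianPDFReal _ _

theorem integral_gaussDensity_mul_abs_apply {d : ℕ} {σ : ℝ} (hσ : 0 < σ) (i : Fin d) :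
    ∫ z, gaussDensity d σ z * |z i| = 2 * σ / √(2 * Real.pi) := by
  rw [← (PiLp.volume_preserving_toLp (Fin d)).integral_comp
    (MeasurableEquiv.toLp 2 _).measurableEmbedding]
  simp only [gaussDensity_mul_abs_eq_prod hσ]
  rw [integral_fintype_prod_volume_eq_prod, Finset.prod_eq_single i]
  · simpa using integral_abs_mul_gaussianPDFReal hσ
  · intro j _ hj
    have hv : (σ ^ 2).toNNReal ≠ 0 := by simpa using hσ.ne'
    simpa [hj] using ProbabilityTheory.integral_gaussianPDFReal_eq_one 0 hv
  · simp

theorem lintegral_gaussDensity_mul_abs_inner {d : ℕ} {σ : ℝ} (hσ : 0 < σ)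
    (δ : EuclideanSpace ℝ (Fin d)) :
    ∫⁻ z, ENNReal.ofReal (gaussDensity d σ z * |inner ℝ z δ|) =
      ENNReal.ofReal (2 * σ / √(2 * Real.pi) * ‖δ‖) := by
  obtain rfl | hδ := eq_or_ne δ 0
  · simp
  have hd : 0 < d := by
    rcases Nat.eq_zero_or_pos d with rfl | h
    · exact absurd (Subsingleton.elim δ 0) hδ
    · exact h
  let i : Fin d := ⟨0, hd⟩
  have hnorm : ‖(‖δ‖⁻¹ • δ)‖ = 1 := by
    simp [norm_smul, hδ]
  obtain ⟨b, hb⟩ := Orthonormal.exists_orthonormalBasis_extension_of_card_eq (𝕜 := ℝ)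
    (E := EuclideanSpace ℝ (Fin d)) (ι := Fin d) (by simp) (v := fun _ ↦ ‖δ‖⁻¹ • δ) (s := {i})
    ⟨fun _ ↦ hnorm, fun j k hjk ↦ absurd (Subsingleton.elim j k) hjk⟩
  have hinner (z : EuclideanSpace ℝ (Fin d)) : inner ℝ z δ = ‖δ‖ * b.repr z i := by
    rw [b.repr_apply_apply, hb i rfl, real_inner_smul_left, real_inner_comm]
    field_simp
  have hrot (z : EuclideanSpace ℝ (Fin d)) : gaussDensity d σ z * |inner ℝ z δ| =
      ‖δ‖ * (gaussDensity d σ (b.repr z) * |b.repr z i|) := by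
    rw [hinner, abs_mul, abs_norm, gaussDensity, gaussDensity, b.repr.norm_map]
    ring
  simp only [hrot]
  rw [b.measurePreserving_repr.lintegral_comp_emb b.repr.toHomeomorph.measurableEmbedding
    (fun z ↦ ENNReal.ofReal (‖δ‖ * (gaussDensity d σ z * |z i|))),
    ← ofReal_integral_eq_lintegral_ofReal
      ((integrable_gaussDensity_mul_abs_apply hσ i).const_mul _)
      (ae_of_all _ fun z ↦ mul_nonneg (norm_nonneg _)
        (mul_nonneg (gaussDensity_nonneg _ _ _) (abs_nonneg _))),
    integral_const_mul, integral_gaussDensity_mul_abs_apply hσ, mul_comm]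

theorem hasDerivAt_gaussDensity_sub_smul {d : ℕ} {σ : ℝ} (hσ : 0 < σ)
    (η δ : EuclideanSpace ℝ (Fin d)) (t : ℝ) :
    HasDerivAt (fun s : ℝ ↦ gaussDensity d σ (η - s • δ))
      ((σ ^ 2)⁻¹ * (gaussDensity d σ (η - t • δ) * inner ℝ (η - t • δ) δ)) t := by
  have h1 : HasDerivAt (fun s : ℝ ↦ η - s • δ) (-δ) t := by
    simpa using ((hasDerivAt_id t).smul_const δ).const_sub η
  refine (((h1.norm_sq.neg.div_const (2 * σ ^ 2)).exp).const_mul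
    ((2 * Real.pi * σ ^ 2) ^ (-(d : ℝ) / 2))).congr_deriv ?_
  simp only [gaussDensity, inner_neg_right, Pi.neg_apply]
  field_simp

theorem lintegral_enorm_gaussDensity_sub_le {d : ℕ} {σ : ℝ} (hσ : 0 < σ)
    (δ : EuclideanSpace ℝ (Fin d)) :
    ∫⁻ η, ‖gaussDensity d σ η - gaussDensity d σ (η - δ)‖ₑ ≤
      ENNReal.ofReal (2 / (√(2 * Real.pi) * σ) * ‖δ‖) := by
  have hc := continuous_gaussDensity d σ
  let q (z : EuclideanSpace ℝ (Fin d)) : ℝ := (σ ^ 2)⁻¹ * (gaussDensity d σ z * inner ℝ z δ)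
  have hq : Continuous q := by fun_prop
  have hpt (η : EuclideanSpace ℝ (Fin d)) :
      ‖gaussDensity d σ η - gaussDensity d σ (η - δ)‖ₑ ≤
        ∫⁻ t in Set.Ioc (0 : ℝ) 1, ‖q (η - t • δ)‖ₑ := by
    have h := intervalIntegral.integral_eq_sub_of_hasDerivAt (a := 0) (b := 1)
      (fun t _ ↦ hasDerivAt_gaussDensity_sub_smul hσ η δ t)
      (Continuous.intervalIntegrable (by fun_prop) _ _)
    rw [one_smul, zero_smul, sub_zero, intervalIntegral.integral_of_le zero_le_one] at h
    rw [← enorm_neg, neg_sub, ← h]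
    exact enorm_integral_le_lintegral_enorm _
  have hqe (z : EuclideanSpace ℝ (Fin d)) : ‖q z‖ₑ =
      ENNReal.ofReal (σ ^ 2)⁻¹ * ENNReal.ofReal (gaussDensity d σ z * |inner ℝ z δ|) := by
    rw [← ENNReal.ofReal_mul (by positivity), Real.enorm_eq_ofReal_abs, abs_mul, abs_mul,
      abs_of_nonneg (gaussDensity_nonneg d σ z), abs_of_pos (by positivity : 0 < (σ ^ 2)⁻¹)]
  calc ∫⁻ η, ‖gaussDensity d σ η - gaussDensity d σ (η - δ)‖ₑ
      ≤ ∫⁻ η, ∫⁻ t in Set.Ioc (0 : ℝ) 1, ‖q (η - t • δ)‖ₑ := lintegral_mono hpt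
    _ = ∫⁻ t in Set.Ioc (0 : ℝ) 1, ∫⁻ η, ‖q (η - t • δ)‖ₑ :=
      lintegral_lintegral_swap (Continuous.measurable (by fun_prop)).aemeasurable
    _ = ∫⁻ η, ‖q η‖ₑ := by
      simp [fun t : ℝ ↦ lintegral_sub_right_eq_self (μ := volume) (fun z ↦ ‖q z‖ₑ) (t • δ)]
    _ = ENNReal.ofReal (2 / (√(2 * Real.pi) * σ) * ‖δ‖) := by
      simp only [hqe]
      rw [lintegral_const_mul' _ _ ENNReal.ofReal_ne_top, lintegral_gaussDensity_mul_abs_inner hσ,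
        ← ENNReal.ofReal_mul (by positivity)]
      congr 1
      field_simp

/-- Lemma 1: Gaussian smoothing of a bounded measurable function is
`M/(√(2π)σ)`-Lipschitz, where `M = 2 sup ‖f‖`. -/
theorem smoothing_lipschitz (d m : ℕ) (σ : ℝ) (hσ : 0 < σ)
    (f : EuclideanSpace ℝ (Fin d) → EuclideanSpace ℝ (Fin m))
    (hf : Measurable f) (hb : BddAbove (Set.range fun x => ‖f x‖))
    (M : ℝ) (hM : M = 2 * ⨆ x, ‖f x‖)
    (g : EuclideanSpace ℝ (Fin d) → EuclideanSpace ℝ (Fin m))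
    (hg : ∀ x, g x = ∫ η, gaussDensity d σ η • f (x + η))
    (x δ : EuclideanSpace ℝ (Fin d)) :
    ‖g x - g (x + δ)‖ ≤ M / (Real.sqrt (2 * Real.pi) * σ) * ‖δ‖ := by
  have hfb (y : EuclideanSpace ℝ (Fin d)) : ‖f y‖ ≤ M / 2 := by
    rw [hM, mul_div_cancel_left₀ _ two_ne_zero]
    exact le_ciSup hb y
  have hM0 : 0 ≤ M / 2 := (norm_nonneg _).trans (hfb x)
  have hint : Integrable fun η ↦ gaussDensity d σ η • f (x + η) :=
    (integrable_gaussDensity d hσ).smul_bdd (M / 2)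
      (hf.comp (measurable_const_add x)).aestronglyMeasurable (ae_of_all _ fun _ ↦ hfb _)
  have hint' : Integrable fun η ↦ gaussDensity d σ (η - δ) • f (x + η) :=
    ((integrable_gaussDensity d hσ).comp_sub_right δ).smul_bdd (M / 2)
      (hf.comp (measurable_const_add x)).aestronglyMeasurable (ae_of_all _ fun _ ↦ hfb _)
  have hshift : g (x + δ) = ∫ η, gaussDensity d σ (η - δ) • f (x + η) := by
    rw [hg, ← integral_sub_right_eq_self _ δ]
    simp [add_assoc]
  have hbound : ‖g x - g (x + δ)‖ₑ ≤
      ENNReal.ofReal (2 / (√(2 * Real.pi) * σ) * ‖δ‖) * ENNReal.ofReal (M / 2) := by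
    rw [hshift, hg, ← integral_sub hint hint']
    simp only [← sub_smul]
    calc _ ≤ ∫⁻ η, ‖(gaussDensity d σ η - gaussDensity d σ (η - δ)) • f (x + η)‖ₑ :=
          enorm_integral_le_lintegral_enorm _
      _ ≤ ∫⁻ η, ‖gaussDensity d σ η - gaussDensity d σ (η - δ)‖ₑ * ENNReal.ofReal (M / 2) := by
          refine lintegral_mono fun η ↦ ?_
          rw [enorm_smul]
          gcongr
          rw [← ofReal_norm]
          exact ENNReal.ofReal_le_ofReal (hfb _)
      _ ≤ _ := by
          rw [lintegral_mul_const' _ _ ENNReal.ofReal_ne_top]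
          gcongr
          exact lintegral_enorm_gaussDensity_sub_le hσ δ
  rw [← ENNReal.ofReal_mul (by positivity), ← ofReal_norm,
    ENNReal.ofReal_le_ofReal_iff (by positivity)] at hbound
  refine hbound.trans_eq ?_
  field_simp
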